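/- Let A be a skew left brace, u ∈ A and t ≥ 1. Then u ∈ Ann_t(A) if and only if m(a₁a₂⋯a_t u) = 1 for every word m ∈ M with deg(m) = t and all a₁,…,a_t ∈ A. -/

import Mathlib

set_option linter.unusedVariables false

universe u v

/-- A skew left brace: a carrier with two group structures `(A,·)` (written `dmul`) and
`(A,∘)` (written `cmul`) sharing the same identity `ident`, satisfying
`a ∘ (b · c) = (a ∘ b) · a⁻¹ · (a ∘ c)`. -/
class SkewBrace (A : Type u) where
  dmul : A → A → A
  ident : A
  dinv : A → A
  cmul : A → A → A
  cinv : A → A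
  dmul_assoc : ∀ a b c : A, dmul (dmul a b) c = dmul a (dmul b c)
  ident_dmul : ∀ a : A, dmul ident a = a
  dmul_ident : ∀ a : A, dmul a ident = a
  dinv_dmul : ∀ a : A, dmul (dinv a) a = ident
  dmul_dinv : ∀ a : A, dmul a (dinv a) = ident
  cmul_assoc : ∀ a b c : A, cmul (cmul a b) c = cmul a (cmul b c)
  ident_cmul : ∀ a : A, cmul ident a = a
  cmul_ident : ∀ a : A, cmul a ident = a
  cinv_cmul : ∀ a : A, cmul (cinv a) a = ident
  cmul_cinv : ∀ a : A, cmul a (cinv a) = ident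
  compat : ∀ a b c : A, cmul a (dmul b c) = dmul (dmul (cmul a b) (dinv a)) (cmul a c)

namespace SkewBrace

variable {A : Type u} [SkewBrace A]

/-- The lambda map `λ_a(b) = a⁻¹ · (a ∘ b)`. -/
def lam (a b : A) : A := dmul (dinv a) (cmul a b)

/-- The star operation `a * b = λ_a(b) · b⁻¹`. -/
def bstar (a b : A) : A := dmul (lam a b) (dinv b)

/-- The dot commutator `[a,b]· = a · b · a⁻¹ · b⁻¹`. -/
def dcomm (a b : A) : A := dmul (dmul (dmul a b) (dinv a)) (dinv b)

/-- The circle commutator `[a,b]∘ = a ∘ b ∘ ā ∘ b̄`. -/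
def ccomm (a b : A) : A := cmul (cmul (cmul a b) (cinv a)) (cinv b)

/-- Membership in the subgroup of `(A,·)` generated by a subset. -/
inductive dclosure (S : Set A) : A → Prop
  | mem {x : A} : x ∈ S → dclosure S x
  | one : dclosure S ident
  | mul {x y : A} : dclosure S x → dclosure S y → dclosure S (dmul x y)
  | inv {x : A} : dclosure S x → dclosure S (dinv x)

/-- The subgroup of `(A,·)` generated by a subset, as a set. -/
def dcl (S : Set A) : Set A := {x | dclosure S x}

/-- Membership in the subgroup of `(A,∘)` generated by a subset. -/
inductive cclosure (S : Set A) : A → Prop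
  | mem {x : A} : x ∈ S → cclosure S x
  | one : cclosure S ident
  | mul {x y : A} : cclosure S x → cclosure S y → cclosure S (cmul x y)
  | inv {x : A} : cclosure S x → cclosure S (cinv x)

/-- The subgroup of `(A,∘)` generated by a subset, as a set. -/
def ccl (S : Set A) : Set A := {x | cclosure S x}

/-- The set `{x * y : x ∈ I, y ∈ J}` (star values). -/
def starSet (I J : Set A) : Set A := {x | ∃ a ∈ I, ∃ b ∈ J, x = bstar a b}

/-- The set of dot commutators `[a,b]·` with `a ∈ I`, `b ∈ J`. -/
def dcommSet (I J : Set A) : Set A := {x | ∃ a ∈ I, ∃ b ∈ J, x = dcomm a b}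

/-- The set of circle commutators `[a,b]∘` with `a ∈ I`, `b ∈ J`. -/
def ccommSet (I J : Set A) : Set A := {x | ∃ a ∈ I, ∃ b ∈ J, x = ccomm a b}

/-- The lower central series `Γ_n(A)` of the skew brace `A` (`Gamma A n = Γ_n(A)` for `n ≥ 1`):
`Γ₁(A) = A` and `Γ_n(A) = ⟨A * Γ_{n-1}(A), Γ_{n-1}(A) * A, [A,Γ_{n-1}(A)]·⟩·`. -/
def Gamma (A : Type u) [SkewBrace A] : ℕ → Set A
  | 0 => Set.univ
  | 1 => Set.univ
  | (n+2) =>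
      dcl (starSet Set.univ (Gamma A (n+1)) ∪ starSet (Gamma A (n+1)) Set.univ ∪
        dcommSet Set.univ (Gamma A (n+1)))

/-- The lower central series `γ_n(A,∘)` of the group `(A,∘)`
(`gammaCirc A n = γ_n(A,∘)` for `n ≥ 1`). -/
def gammaCirc (A : Type u) [SkewBrace A] : ℕ → Set A
  | 0 => Set.univ
  | 1 => Set.univ
  | (n+2) => ccl (ccommSet (gammaCirc A (n+1)) Set.univ)

/-- The series `Γ̄_n(A)`: `Γ̄₁(A) = A`, `Γ̄_n(A) = ⟨A * Γ̄_{n-1}(A), [A, Γ̄_{n-1}(A)]·⟩·`. -/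
def GammaBar (A : Type u) [SkewBrace A] : ℕ → Set A
  | 0 => Set.univ
  | 1 => Set.univ
  | (n+2) =>
      dcl (starSet Set.univ (GammaBar A (n+1)) ∪ dcommSet Set.univ (GammaBar A (n+1)))

/-- The annihilator series: `AnnS A n = Ann_n(A)`, with `Ann_0(A) = 1` and
`Ann_n(A) = {a | a*b, b*a, [a,b]· ∈ Ann_{n-1}(A) for all b}`. -/
def AnnS (A : Type u) [SkewBrace A] : ℕ → Set A
  | 0 => {ident}
  | (n+1) => {a | ∀ b : A, bstar a b ∈ AnnS A n ∧ bstar b a ∈ AnnS A n ∧ dcomm a b ∈ AnnS A n}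

/-- The alphabet `X = {γ·, γ̄·, *, *̄}` of brace commutator symbols. -/
inductive BWord : Type
  | g | gbar | s | sbar

/-- Evaluation of a single symbol of `X`. -/
def evalX : BWord → A → A → A
  | BWord.g => dcomm
  | BWord.gbar => fun a b => dcomm b a
  | BWord.s => bstar
  | BWord.sbar => fun a b => bstar b a

/-- `evalW e a n` is the value `m(a₀ a₁ ⋯ a_n)` of the degree-`n` brace commutator word
`m = (e 0)(e 1)⋯(e (n-1))` on the arguments `a 0, …, a n`:
`m(a₀ ⋯ a_n) = (e 0)(a₀, (e 1)(a₁, …, (e (n-1))(a_{n-1}, a_n)⋯))`. -/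
def evalW : (ℕ → BWord) → (ℕ → A) → ℕ → A
  | _, a, 0 => a 0
  | e, a, (n+1) => evalX (e 0) (a 0) (evalW (fun i => e (i+1)) (fun i => a (i+1)) n)

/-- `Asub A t = A_{(t)}`, the subgroup of `(A,·)` generated by all values of brace commutator
words of degree `≥ t`. -/
def Asub (A : Type u) [SkewBrace A] (t : ℕ) : Set A :=
  dcl {x | ∃ s : ℕ, t ≤ s ∧ ∃ (e : ℕ → BWord) (a : ℕ → A), x = evalW e a s}

/-- `Sset A r = S_r(A)`, the set of all values of brace commutator words of degree exactly `r`
(`S_0(A) = A`). -/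
def Sset (A : Type u) [SkewBrace A] (r : ℕ) : Set A :=
  {x | ∃ (e : ℕ → BWord) (a : ℕ → A), x = evalW e a r}

/-- `cosetRel I a b` says that `b` lies in the coset `I · a`. -/
def cosetRel (I : Set A) (a b : A) : Prop := ∃ c ∈ I, b = dmul c a

/-- The class `I_n`: the maps `φ_m : (A/Ann_n(A))^{n+1} → A_{(n)}`,
`(Ann_n(A)a₁, …, Ann_n(A)a_{n+1}) ↦ m(a₁⋯a_{n+1})`, are well defined for every word `m` of
degree `n`. -/
def InClass (A : Type u) [SkewBrace A] (n : ℕ) : Prop :=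
  ∀ (e : ℕ → BWord) (a b : ℕ → A),
    (∀ i : ℕ, i ≤ n → cosetRel (AnnS A n) (a i) (b i)) →
    evalW e b n = evalW e a n

/-- A skew left brace `(A,·,∘)` is symmetric if `(A,∘,·)` is also a skew left brace, i.e.
`a · (b ∘ c) = (a · b) ∘ ā ∘ (a · c)`. -/
def IsSymmetric (A : Type u) [SkewBrace A] : Prop :=
  ∀ a b c : A, dmul a (cmul b c) = cmul (cmul (dmul a b) (cinv a)) (dmul a c)

/-- A sub-skew brace: a subset which is a subgroup of both `(A,·)` and `(A,∘)`. -/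
structure IsSubBrace (A : Type u) [SkewBrace A] (S : Set A) : Prop where
  ident_mem : ident ∈ S
  dmul_mem : ∀ {x y : A}, x ∈ S → y ∈ S → dmul x y ∈ S
  dinv_mem : ∀ {x : A}, x ∈ S → dinv x ∈ S
  cmul_mem : ∀ {x y : A}, x ∈ S → y ∈ S → cmul x y ∈ S
  cinv_mem : ∀ {x : A}, x ∈ S → cinv x ∈ S

/-- An ideal of a skew brace: a subgroup of `(A,·)`, normal in `(A,·)` and `(A,∘)`,
and invariant under all `λ_a`. -/
structure IsIdeal (A : Type u) [SkewBrace A] (I : Set A) : Prop where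
  ident_mem : ident ∈ I
  dmul_mem : ∀ {x y : A}, x ∈ I → y ∈ I → dmul x y ∈ I
  dinv_mem : ∀ {x : A}, x ∈ I → dinv x ∈ I
  dconj_mem : ∀ (a : A) {x : A}, x ∈ I → dmul (dmul a x) (dinv a) ∈ I
  cconj_mem : ∀ (a : A) {x : A}, x ∈ I → cmul (cmul a x) (cinv a) ∈ I
  lam_mem : ∀ (a : A) {x : A}, x ∈ I → lam a x ∈ I

/-- A homomorphism of skew braces. -/
structure IsBraceHom {A : Type u} {B : Type v} [SkewBrace A] [SkewBrace B] (f : A → B) : Prop where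
  map_dmul : ∀ x y : A, f (dmul x y) = dmul (f x) (f y)
  map_cmul : ∀ x y : A, f (cmul x y) = cmul (f x) (f y)

/-- The data of an isoclinism of skew braces along ideals `I` of `A` and `J` of `B`:
`ξ` induces a brace isomorphism `A/I → B/J` and `θ` restricts to a brace isomorphism
`Γ₂(A) → Γ₂(B)` compatible with the commutator and star maps. -/
structure IsoclinismData (A : Type u) (B : Type v) [SkewBrace A] [SkewBrace B]
    (I : Set A) (J : Set B) (ξ θ : A → B) : Prop where
  xi_resp : ∀ a a' : A, cosetRel I a a' ↔ cosetRel J (ξ a) (ξ a')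
  xi_surj : ∀ b : B, ∃ a : A, cosetRel J b (ξ a)
  xi_dmul : ∀ a a' : A, cosetRel J (dmul (ξ a) (ξ a')) (ξ (dmul a a'))
  xi_cmul : ∀ a a' : A, cosetRel J (cmul (ξ a) (ξ a')) (ξ (cmul a a'))
  theta_maps : ∀ x ∈ Gamma A 2, θ x ∈ Gamma B 2
  theta_inj : ∀ x ∈ Gamma A 2, ∀ y ∈ Gamma A 2, θ x = θ y → x = y
  theta_surj : ∀ y ∈ Gamma B 2, ∃ x ∈ Gamma A 2, θ x = y
  theta_dmul : ∀ x ∈ Gamma A 2, ∀ y ∈ Gamma A 2, θ (dmul x y) = dmul (θ x) (θ y)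
  theta_cmul : ∀ x ∈ Gamma A 2, ∀ y ∈ Gamma A 2, θ (cmul x y) = cmul (θ x) (θ y)
  compat_dcomm : ∀ a₁ a₂ : A, ∀ b₁ b₂ : B, cosetRel J b₁ (ξ a₁) → cosetRel J b₂ (ξ a₂) →
    θ (dcomm a₁ a₂) = dcomm b₁ b₂
  compat_star : ∀ a₁ a₂ : A, ∀ b₁ b₂ : B, cosetRel J b₁ (ξ a₁) → cosetRel J b₂ (ξ a₂) →
    θ (bstar a₁ a₂) = bstar b₁ b₂

/-- Isoclinism (1-isoclinism) of skew left braces. -/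
def Isoclinic (A : Type u) (B : Type v) [SkewBrace A] [SkewBrace B] : Prop :=
  ∃ ξ θ : A → B, IsoclinismData A B (AnnS A 1) (AnnS B 1) ξ θ

/-- The data of an `n`-isoclinism of skew braces: `ξ` induces a brace isomorphism
`A/Ann_n(A) → B/Ann_n(B)` and `θ` restricts to a brace isomorphism `A_{(n)} → B_{(n)}`
commuting with all brace commutator word maps of degree `n`. -/
structure IsoclinismDataN (A : Type u) (B : Type v) [SkewBrace A] [SkewBrace B]
    (n : ℕ) (ξ θ : A → B) : Prop where
  xi_resp : ∀ a a' : A, cosetRel (AnnS A n) a a' ↔ cosetRel (AnnS B n) (ξ a) (ξ a')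
  xi_surj : ∀ b : B, ∃ a : A, cosetRel (AnnS B n) b (ξ a)
  xi_dmul : ∀ a a' : A, cosetRel (AnnS B n) (dmul (ξ a) (ξ a')) (ξ (dmul a a'))
  xi_cmul : ∀ a a' : A, cosetRel (AnnS B n) (cmul (ξ a) (ξ a')) (ξ (cmul a a'))
  theta_maps : ∀ x ∈ Asub A n, θ x ∈ Asub B n
  theta_inj : ∀ x ∈ Asub A n, ∀ y ∈ Asub A n, θ x = θ y → x = y
  theta_surj : ∀ y ∈ Asub B n, ∃ x ∈ Asub A n, θ x = y
  theta_dmul : ∀ x ∈ Asub A n, ∀ y ∈ Asub A n, θ (dmul x y) = dmul (θ x) (θ y)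
  theta_cmul : ∀ x ∈ Asub A n, ∀ y ∈ Asub A n, θ (cmul x y) = cmul (θ x) (θ y)
  compat : ∀ (e : ℕ → BWord) (a : ℕ → A) (b : ℕ → B),
    (∀ i : ℕ, i ≤ n → cosetRel (AnnS B n) (b i) (ξ (a i))) →
    θ (evalW e a n) = evalW e b n

/-- `n`-isoclinism of skew left braces. -/
def IsoclinicN (A : Type u) (B : Type v) [SkewBrace A] [SkewBrace B] (n : ℕ) : Prop :=
  ∃ ξ θ : A → B, IsoclinismDataN A B n ξ θ

/-- The product set `S · T = {s · t : s ∈ S, t ∈ T}` in `(A,·)`. -/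
def setDProd (S T : Set A) : Set A := {x | ∃ s ∈ S, ∃ t ∈ T, x = dmul s t}

/-- The product set `S ∘ T = {s ∘ t : s ∈ S, t ∈ T}` in `(A,∘)`. -/
def setCProd (S T : Set A) : Set A := {x | ∃ s ∈ S, ∃ t ∈ T, x = cmul s t}

/-- The skew brace structure on a sub-skew brace. -/
def subBrace (S : Set A) (h : IsSubBrace A S) : SkewBrace S where
  dmul x y := ⟨dmul x.1 y.1, h.dmul_mem x.2 y.2⟩
  ident := ⟨ident, h.ident_mem⟩
  dinv x := ⟨dinv x.1, h.dinv_mem x.2⟩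
  cmul x y := ⟨cmul x.1 y.1, h.cmul_mem x.2 y.2⟩
  cinv x := ⟨cinv x.1, h.cinv_mem x.2⟩
  dmul_assoc a b c := Subtype.ext (dmul_assoc a.1 b.1 c.1)
  ident_dmul a := Subtype.ext (ident_dmul a.1)
  dmul_ident a := Subtype.ext (dmul_ident a.1)
  dinv_dmul a := Subtype.ext (dinv_dmul a.1)
  dmul_dinv a := Subtype.ext (dmul_dinv a.1)
  cmul_assoc a b c := Subtype.ext (cmul_assoc a.1 b.1 c.1)
  ident_cmul a := Subtype.ext (ident_cmul a.1)
  cmul_ident a := Subtype.ext (cmul_ident a.1)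
  cinv_cmul a := Subtype.ext (cinv_cmul a.1)
  cmul_cinv a := Subtype.ext (cmul_cinv a.1)
  compat a b c := Subtype.ext (compat a.1 b.1 c.1)

/-- The direct product of two skew braces, with componentwise operations. -/
instance prodBrace (A : Type u) (B : Type v) [SkewBrace A] [SkewBrace B] :
    SkewBrace (A × B) where
  dmul p q := (dmul p.1 q.1, dmul p.2 q.2)
  ident := (ident, ident)
  dinv p := (dinv p.1, dinv p.2)
  cmul p q := (cmul p.1 q.1, cmul p.2 q.2)
  cinv p := (cinv p.1, cinv p.2)
  dmul_assoc a b c := Prod.ext_iff.mpr ⟨dmul_assoc _ _ _, dmul_assoc _ _ _⟩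
  ident_dmul a := Prod.ext_iff.mpr ⟨ident_dmul _, ident_dmul _⟩
  dmul_ident a := Prod.ext_iff.mpr ⟨dmul_ident _, dmul_ident _⟩
  dinv_dmul a := Prod.ext_iff.mpr ⟨dinv_dmul _, dinv_dmul _⟩
  dmul_dinv a := Prod.ext_iff.mpr ⟨dmul_dinv _, dmul_dinv _⟩
  cmul_assoc a b c := Prod.ext_iff.mpr ⟨cmul_assoc _ _ _, cmul_assoc _ _ _⟩
  ident_cmul a := Prod.ext_iff.mpr ⟨ident_cmul _, ident_cmul _⟩
  cmul_ident a := Prod.ext_iff.mpr ⟨cmul_ident _, cmul_ident _⟩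
  cinv_cmul a := Prod.ext_iff.mpr ⟨cinv_cmul _, cinv_cmul _⟩
  cmul_cinv a := Prod.ext_iff.mpr ⟨cmul_cinv _, cmul_cinv _⟩
  compat a b c := Prod.ext_iff.mpr ⟨compat _ _ _, compat _ _ _⟩

end SkewBrace

namespace SkewBrace

section Groups

variable (A : Type u) [SkewBrace A]

/-- The group `(A,·)`. -/
abbrev dotGroup : Group A where
  mul := dmul
  one := ident
  inv := dinv
  mul_assoc := dmul_assoc
  one_mul := ident_dmul
  mul_one := dmul_ident
  inv_mul_cancel := dinv_dmul

/-- The group `(A,∘)`. -/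
abbrev circGroup : Group A where
  mul := cmul
  one := ident
  inv := cinv
  mul_assoc := cmul_assoc
  one_mul := ident_cmul
  mul_one := cmul_ident
  inv_mul_cancel := cinv_cmul

end Groups

variable {A : Type u} [SkewBrace A]

theorem dinv_ident : dinv (ident : A) = ident :=
  letI := dotGroup A
  inv_one (G := A)

theorem dinv_dmul_rev (x y : A) : dinv (dmul x y) = dmul (dinv y) (dinv x) :=
  letI := dotGroup A
  mul_inv_rev x y

theorem dmul_dinv_eq_ident {x y : A} : dmul x (dinv y) = ident ↔ x = y :=
  letI := dotGroup A
  mul_inv_eq_one (a := x)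

theorem dinv_dmul_eq_iff {x y z : A} : dmul (dinv x) y = z ↔ y = dmul x z :=
  letI := dotGroup A
  inv_mul_eq_iff_eq_mul (a := x)

theorem cmul_left_cancel {x y z : A} (h : cmul x y = cmul x z) : y = z :=
  letI := circGroup A
  mul_left_cancel (a := x) h

theorem cinv_eq_of_cmul_eq_ident {x y : A} (h : cmul x y = ident) : cinv x = y :=
  cmul_left_cancel ((cmul_cinv x).trans h.symm)

theorem dinv_dcomm (a b : A) : dinv (dcomm a b) = dcomm b a := by
  let := dotGroup A
  change (a * b * a⁻¹ * b⁻¹)⁻¹ = b * a * b⁻¹ * a⁻¹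
  group

theorem bstar_eq_ident_iff {a b : A} : bstar a b = ident ↔ cmul a b = dmul a b := by
  rw [bstar, dmul_dinv_eq_ident, lam, dinv_dmul_eq_iff]

theorem dcomm_eq_ident_iff {a b : A} : dcomm a b = ident ↔ dmul a b = dmul b a := by
  let := dotGroup A
  change a * b * a⁻¹ * b⁻¹ = 1 ↔ a * b = b * a
  rw [mul_inv_eq_one, mul_inv_eq_iff_eq_mul]

theorem mem_annS_one_iff {z : A} :
    z ∈ AnnS A 1 ↔
      ∀ b, cmul z b = dmul z b ∧ cmul b z = dmul b z ∧ dmul z b = dmul b z := by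
  refine forall_congr' fun b => ?_
  exact and_congr bstar_eq_ident_iff (and_congr bstar_eq_ident_iff dcomm_eq_ident_iff)

section Annihilator

variable {z w : A}

theorem cmul_of_mem_annS_one (hz : z ∈ AnnS A 1) (b : A) : cmul z b = dmul z b :=
  (mem_annS_one_iff.1 hz b).1

theorem cmul_of_mem_annS_one_right (hz : z ∈ AnnS A 1) (b : A) : cmul b z = dmul b z :=
  (mem_annS_one_iff.1 hz b).2.1

theorem dmul_comm_of_mem_annS_one (hz : z ∈ AnnS A 1) (b : A) : dmul z b = dmul b z :=
  (mem_annS_one_iff.1 hz b).2.2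

theorem cmul_comm_of_mem_annS_one (hz : z ∈ AnnS A 1) (b : A) : cmul z b = cmul b z := by
  rw [cmul_of_mem_annS_one hz, cmul_of_mem_annS_one_right hz, dmul_comm_of_mem_annS_one hz]

theorem ident_mem_annS_one : (ident : A) ∈ AnnS A 1 :=
  mem_annS_one_iff.2 fun b => by simp only [ident_cmul, ident_dmul, cmul_ident, dmul_ident, and_self]

theorem dmul_mem_annS_one (hz : z ∈ AnnS A 1) (hw : w ∈ AnnS A 1) : dmul z w ∈ AnnS A 1 := by
  refine mem_annS_one_iff.2 fun b => ⟨?_, ?_, ?_⟩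
  · rw [← cmul_of_mem_annS_one hz, cmul_assoc, cmul_of_mem_annS_one hz, cmul_of_mem_annS_one hw,
      cmul_of_mem_annS_one hz, dmul_assoc]
  · rw [← cmul_of_mem_annS_one hz, ← cmul_assoc, cmul_of_mem_annS_one_right hw,
      cmul_of_mem_annS_one_right hz, cmul_of_mem_annS_one hz, dmul_assoc]
  · rw [dmul_assoc, dmul_comm_of_mem_annS_one hw, ← dmul_assoc, dmul_comm_of_mem_annS_one hz,
      dmul_assoc]

theorem cmul_dinv_of_mem_annS_one (hz : z ∈ AnnS A 1) : cmul z (dinv z) = ident := by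
  rw [cmul_of_mem_annS_one hz, dmul_dinv]

theorem dmul_dinv_dmul_cancel (z b : A) : dmul z (dmul (dinv z) b) = b := by
  rw [← dmul_assoc, dmul_dinv, ident_dmul]

theorem dinv_mem_annS_one (hz : z ∈ AnnS A 1) : dinv z ∈ AnnS A 1 := by
  have hcomm (b : A) : dmul (dinv z) b = dmul b (dinv z) := by
    rw [dinv_dmul_eq_iff, ← dmul_assoc, dmul_comm_of_mem_annS_one hz, dmul_assoc, dmul_dinv,
      dmul_ident]
  refine mem_annS_one_iff.2 fun b => ⟨?_, ?_, hcomm b⟩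
  · apply cmul_left_cancel (x := z)
    rw [← cmul_assoc, cmul_dinv_of_mem_annS_one hz, ident_cmul, cmul_of_mem_annS_one hz,
      dmul_dinv_dmul_cancel]
  · apply cmul_left_cancel (x := z)
    rw [← cmul_assoc, cmul_comm_of_mem_annS_one hz, cmul_assoc, cmul_dinv_of_mem_annS_one hz,
      cmul_ident, cmul_of_mem_annS_one hz, ← hcomm, dmul_dinv_dmul_cancel]

theorem dmul_mem_annS_one_iff (hz : z ∈ AnnS A 1) : dmul z w ∈ AnnS A 1 ↔ w ∈ AnnS A 1 := by
  refine ⟨fun h => ?_, dmul_mem_annS_one hz⟩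
  have := dmul_mem_annS_one (dinv_mem_annS_one hz) h
  rwa [← dmul_assoc, dinv_dmul, ident_dmul] at this

end Annihilator

section Congruence

variable {x y : A}

theorem cosetRel_annS_one_dmul_left (a : A) (h : cosetRel (AnnS A 1) x y) :
    cosetRel (AnnS A 1) (dmul a x) (dmul a y) := by
  obtain ⟨z, hz, rfl⟩ := h
  exact ⟨z, hz, by rw [← dmul_assoc, ← dmul_assoc, dmul_comm_of_mem_annS_one hz]⟩

theorem cosetRel_annS_one_dmul_right (a : A) (h : cosetRel (AnnS A 1) x y) :
    cosetRel (AnnS A 1) (dmul x a) (dmul y a) := by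
  obtain ⟨z, hz, rfl⟩ := h
  exact ⟨z, hz, dmul_assoc _ _ _⟩

theorem cosetRel_annS_one_dinv (h : cosetRel (AnnS A 1) x y) :
    cosetRel (AnnS A 1) (dinv x) (dinv y) := by
  obtain ⟨z, hz, rfl⟩ := h
  have hz' := dinv_mem_annS_one hz
  exact ⟨dinv z, hz', by rw [dinv_dmul_rev, dmul_comm_of_mem_annS_one hz']⟩

theorem cosetRel_annS_one_cmul_left (a : A) (h : cosetRel (AnnS A 1) x y) :
    cosetRel (AnnS A 1) (cmul a x) (cmul a y) := by
  obtain ⟨z, hz, rfl⟩ := h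
  refine ⟨z, hz, ?_⟩
  rw [← cmul_of_mem_annS_one hz, ← cmul_of_mem_annS_one hz, ← cmul_assoc, ← cmul_assoc,
    cmul_comm_of_mem_annS_one hz]

theorem cosetRel_annS_one_cmul_right (a : A) (h : cosetRel (AnnS A 1) x y) :
    cosetRel (AnnS A 1) (cmul x a) (cmul y a) := by
  obtain ⟨z, hz, rfl⟩ := h
  refine ⟨z, hz, ?_⟩
  rw [← cmul_of_mem_annS_one hz, ← cmul_of_mem_annS_one hz, cmul_assoc]

theorem cosetRel_annS_one_cinv (h : cosetRel (AnnS A 1) x y) :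
    cosetRel (AnnS A 1) (cinv x) (cinv y) := by
  obtain ⟨z, hz, rfl⟩ := h
  have hz' := dinv_mem_annS_one hz
  refine ⟨dinv z, hz', cinv_eq_of_cmul_eq_ident ?_⟩
  rw [← cmul_of_mem_annS_one hz, ← cmul_of_mem_annS_one hz', cmul_comm_of_mem_annS_one hz',
    cmul_assoc, ← cmul_assoc x, cmul_cinv, ident_cmul, cmul_dinv_of_mem_annS_one hz]

end Congruence

/-- The quotient `A / Ann(A)`. -/
abbrev AnnQuotient (A : Type u) [SkewBrace A] : Type u := Quot (cosetRel (AnnS A 1))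

instance annQuotientBrace : SkewBrace (AnnQuotient A) where
  dmul := Quot.map₂ dmul (fun a _ _ => cosetRel_annS_one_dmul_left a)
    (fun _ _ a => cosetRel_annS_one_dmul_right a)
  ident := Quot.mk _ ident
  dinv := Quot.map dinv fun _ _ => cosetRel_annS_one_dinv
  cmul := Quot.map₂ cmul (fun a _ _ => cosetRel_annS_one_cmul_left a)
    (fun _ _ a => cosetRel_annS_one_cmul_right a)
  cinv := Quot.map cinv fun _ _ => cosetRel_annS_one_cinv
  dmul_assoc := by rintro ⟨a⟩ ⟨b⟩ ⟨c⟩; exact congrArg (Quot.mk _) (dmul_assoc a b c)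
  ident_dmul := by rintro ⟨a⟩; exact congrArg (Quot.mk _) (ident_dmul a)
  dmul_ident := by rintro ⟨a⟩; exact congrArg (Quot.mk _) (dmul_ident a)
  dinv_dmul := by rintro ⟨a⟩; exact congrArg (Quot.mk _) (dinv_dmul a)
  dmul_dinv := by rintro ⟨a⟩; exact congrArg (Quot.mk _) (dmul_dinv a)
  cmul_assoc := by rintro ⟨a⟩ ⟨b⟩ ⟨c⟩; exact congrArg (Quot.mk _) (cmul_assoc a b c)
  ident_cmul := by rintro ⟨a⟩; exact congrArg (Quot.mk _) (ident_cmul a)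
  cmul_ident := by rintro ⟨a⟩; exact congrArg (Quot.mk _) (cmul_ident a)
  cinv_cmul := by rintro ⟨a⟩; exact congrArg (Quot.mk _) (cinv_cmul a)
  cmul_cinv := by rintro ⟨a⟩; exact congrArg (Quot.mk _) (cmul_cinv a)
  compat := by rintro ⟨a⟩ ⟨b⟩ ⟨c⟩; exact congrArg (Quot.mk _) (compat a b c)

/-- The projection `A → A / Ann(A)`. -/
def annMk (a : A) : AnnQuotient A := Quot.mk _ a

theorem annMk_eq_ident_iff {a : A} : annMk a = ident ↔ a ∈ AnnS A 1 := by
  constructor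
  · intro h
    let p : AnnQuotient A → Prop := Quot.lift (· ∈ AnnS A 1) <| by
      rintro x _ ⟨z, hz, rfl⟩
      exact propext (dmul_mem_annS_one_iff hz).symm
    have : p (annMk a) := by
      rw [h]
      exact ident_mem_annS_one
    exact this
  · intro h
    exact (Quot.sound ⟨a, h, (dmul_ident a).symm⟩ : Quot.mk (cosetRel (AnnS A 1)) ident = _).symm

theorem mem_annS_succ_iff_annMk (n : ℕ) (a : A) :
    a ∈ AnnS A (n + 1) ↔ annMk a ∈ AnnS (AnnQuotient A) n := by
  induction n generalizing a with
  | zero => exact annMk_eq_ident_iff.symm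
  | succ n ih =>
    constructor
    · rintro h ⟨b⟩
      exact ⟨(ih _).1 (h b).1, (ih _).1 (h b).2.1, (ih _).1 (h b).2.2⟩
    · intro h b
      have hb := h (annMk b)
      exact ⟨(ih _).2 hb.1, (ih _).2 hb.2.1, (ih _).2 hb.2.2⟩

theorem dinv_mem_annS {A : Type u} [SkewBrace A] {n : ℕ} {a : A} (h : a ∈ AnnS A n) :
    dinv a ∈ AnnS A n := by
  induction n generalizing A with
  | zero =>
    obtain rfl : a = ident := h
    exact dinv_ident
  | succ n ih =>
    rw [mem_annS_succ_iff_annMk] at h ⊢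
    exact ih h

theorem mem_annS_succ_iff_evalX {n : ℕ} {a : A} :
    a ∈ AnnS A (n + 1) ↔ ∀ (ε : BWord) (b : A), evalX ε b a ∈ AnnS A n := by
  constructor
  · rintro h (_ | _ | _ | _) b
    · have := dinv_mem_annS (h b).2.2
      rwa [dinv_dcomm] at this
    · exact (h b).2.2
    · exact (h b).2.1
    · exact (h b).1
  · intro h b
    exact ⟨h .sbar b, h .s b, h .gbar b⟩

theorem evalW_congr {e f : ℕ → BWord} {a b : ℕ → A} {n : ℕ} (he : ∀ i < n, e i = f i)
    (ha : ∀ i ≤ n, a i = b i) : evalW e a n = evalW f b n := by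
  induction n generalizing e f a b with
  | zero => exact ha 0 le_rfl
  | succ n ih =>
    rw [evalW, evalW, he 0 n.succ_pos, ha 0 (Nat.zero_le _),
      ih (fun i hi => he (i + 1) (by lia)) fun i hi => ha (i + 1) (by lia)]

theorem evalW_succ_eq_evalW_update (e : ℕ → BWord) (a : ℕ → A) (n : ℕ) :
    evalW e a (n + 1) = evalW e (Function.update a n (evalX (e n) (a n) (a (n + 1)))) n := by
  induction n generalizing e a with
  | zero => simp [evalW]
  | succ n ih =>
    rw [evalW, ih, evalW]
    congr 1
    refine evalW_congr (fun _ _ => rfl) fun i _ => ?_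
    simp [Function.update_apply]

theorem mem_annS_iff_evalW (n : ℕ) (x : A) :
    x ∈ AnnS A n ↔ ∀ (e : ℕ → BWord) (a : ℕ → A), a n = x → evalW e a n = ident := by
  induction n generalizing x with
  | zero =>
    constructor
    · rintro h e a rfl
      exact h
    · intro h
      exact h (fun _ => .g) (fun _ => x) rfl
  | succ n ih =>
    rw [mem_annS_succ_iff_evalX]
    simp only [ih]
    constructor
    · rintro h e a rfl
      rw [evalW_succ_eq_evalW_update]
      exact h (e n) (a n) e _ (Function.update_self ..)
    · intro h ε b e a ha
      rw [← h (Function.update e n ε) (Function.update (Function.update a n b) (n + 1) x)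
        (Function.update_self ..), evalW_succ_eq_evalW_update]
      refine evalW_congr (fun i hi => ?_) fun i hi => ?_
      · rw [Function.update_of_ne hi.ne]
      · obtain rfl | hne := eq_or_ne i n
        · simp [ha]
        · rw [Function.update_of_ne hne, Function.update_of_ne (by lia), Function.update_of_ne hne]

end SkewBrace

open SkewBrace in
/-- Let `A` be a skew left brace, `x ∈ A` and `t ≥ 1`. Then `x ∈ Ann_t(A)` if and only if
`m(a₁ a₂ ⋯ a_t x) = 1` for every brace commutator word `m` of degree `t`
and all `a₁, …, a_t ∈ A`. -/
theorem mem_annS_iff_word_values (A : Type u) [SkewBrace A] (x : A) (t : ℕ) (ht : 1 ≤ t) :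
    x ∈ AnnS A t ↔
      ∀ (e : ℕ → BWord) (a : ℕ → A), a t = x → evalW e a t = ident := by
  exact mem_annS_iff_evalW t x
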